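/- Consider the sparse linear regression model with σ = 1, quantities k=k_n, p=p_n, λ=λ_n depending on n, asymptotics as n→∞. Let π = π_IB(λ; p, k) be the independent block prior and β̂_π the Bayesian estimator (posterior mean) under π. Suppose (log(p/k))/n → 0 and p/k → ∞. If λ > 0 and λ² ≤ (2−δ)·log(p/k) for a fixed constant δ ∈ (0,1), then E_π‖β̂_π − β‖₂² ≥ kλ²·(1+o(1)); equivalently, liminf_n E_π‖β̂_π − β‖₂² / (kλ²) ≥ 1. -/

import Mathlib

open MeasureTheory ProbabilityTheory Filter
open scoped NNReal ENNReal

noncomputable section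

/-- Sample space for the Bayesian model with independent block prior:
a design matrix with columns indexed by `Fin k × Fin m` (block `j`, within-block index
`l`), a noise vector, and the block-spike locations `I : Fin k → Fin m`. -/
abbrev BlockOmega (n k m : ℕ) : Type :=
  ((Fin n → (Fin k × Fin m) → ℝ) × (Fin n → ℝ)) × (Fin k → Fin m)

/-- The joint law: design entries i.i.d. `N(0, 1/n)`, noise entries i.i.d. `N(0,1)`,
and in each of the `k` blocks an independent uniformly random spike location in `[m]`. -/
def blockLaw (n k m : ℕ) : Measure (BlockOmega n k m) :=
  ((Measure.pi fun _ : Fin n =>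
      Measure.pi fun _ : Fin k × Fin m => gaussianReal 0 (n : ℝ≥0)⁻¹).prod
    (Measure.pi fun _ : Fin n => gaussianReal 0 1)).prod
    (Measure.pi fun _ : Fin k => ((m : ℝ≥0∞))⁻¹ • Measure.count)

/-- The signal drawn from the independent block prior `π_IB(λ; p, k)` (with `p = k m`):
in block `j` the coordinate `I j` equals `λ` and all others vanish. -/
def blockSignal (k m : ℕ) (lam : ℝ) (I : Fin k → Fin m) : Fin k × Fin m → ℝ :=
  fun jl => if I jl.1 = jl.2 then lam else 0

/-- The observed data `(X, y)` with `y = X β + z`. -/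
def blockData (n k m : ℕ) (lam : ℝ) (ω : BlockOmega n k m) :
    (Fin n → (Fin k × Fin m) → ℝ) × (Fin n → ℝ) :=
  (ω.1.1, fun i => (∑ jl, ω.1.1 i jl * blockSignal k m lam ω.2 jl) + ω.1.2 i)

/-- Coordinate `jl` of the Bayesian estimator (posterior mean) `β̂_π = E_π(β | y, X)`:
the conditional expectation of `β_{jl}` given the σ-algebra generated by the data. -/
def blockPostMean (n k m : ℕ) (lam : ℝ) (jl : Fin k × Fin m) : BlockOmega n k m → ℝ :=
  (blockLaw n k m)[fun ω => blockSignal k m lam ω.2 jl |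
    MeasurableSpace.comap (blockData n k m lam) inferInstance]

/-- The Bayes risk `E_π ‖β̂_π − β‖₂²` of the posterior mean under the independent
block prior. -/
def blockBayesRisk (n k m : ℕ) (lam : ℝ) : ℝ :=
  ∫ ω, ∑ jl, (blockPostMean n k m lam jl ω - blockSignal k m lam ω.2 jl) ^ 2
    ∂ blockLaw n k m

/-- Tonelli for a product of functions of the individual coordinates. -/
lemma lintegral_pi_prod {ι : Type*} [Fintype ι] {α : ι → Type*} [∀ i, MeasurableSpace (α i)]
    (μ : ∀ i, Measure (α i)) [∀ i, IsProbabilityMeasure (μ i)] (f : ∀ i, α i → ℝ≥0∞)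
    (hf : ∀ i, Measurable (f i)) :
    ∫⁻ x, ∏ i, f i (x i) ∂Measure.pi μ = ∏ i, ∫⁻ x, f i x ∂μ i := by
  rw [lintegral_prod_eq_prod_lintegral_of_indepFun (μ := Measure.pi μ) Finset.univ
    (fun i x => f i (x i)) (iIndepFun_pi fun i => (hf i).aemeasurable)
    fun i => (hf i).comp (measurable_pi_apply i)]
  exact Finset.prod_congr rfl fun i _ => (measurePreserving_eval μ i).lintegral_comp (hf i)

lemma pi_withDensity_prod {ι : Type*} [Fintype ι] {α : ι → Type*} [∀ i, MeasurableSpace (α i)]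
    (μ : ∀ i, Measure (α i)) [∀ i, IsProbabilityMeasure (μ i)] (f : ∀ i, α i → ℝ≥0∞)
    (hf : ∀ i, Measurable (f i)) [∀ i, SigmaFinite ((μ i).withDensity (f i))] :
    Measure.pi (fun i => (μ i).withDensity (f i)) =
      (Measure.pi μ).withDensity fun x => ∏ i, f i (x i) := by
  refine Measure.pi_eq fun s hs => ?_
  rw [withDensity_apply _ (MeasurableSet.univ_pi hs),
    ← lintegral_indicator (MeasurableSet.univ_pi hs)]
  have h : (Set.univ.pi s).indicator (fun x => ∏ i, f i (x i)) =
      fun x => ∏ i, (s i).indicator (f i) (x i) := by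
    ext x
    by_cases hx : x ∈ Set.univ.pi s
    · rw [Set.indicator_of_mem hx]
      exact Finset.prod_congr rfl fun i _ => (Set.indicator_of_mem (hx i trivial) _).symm
    · rw [Set.indicator_of_notMem hx]
      simp only [Set.mem_pi, Set.mem_univ, true_implies, not_forall] at hx
      obtain ⟨i, hi⟩ := hx
      exact (Finset.prod_eq_zero (Finset.mem_univ i) (Set.indicator_of_notMem hi _)).symm
  rw [h, lintegral_pi_prod μ _ fun i => (hf i).indicator (hs i)]
  exact Finset.prod_congr rfl fun i _ => by
    rw [lintegral_indicator (hs i), withDensity_apply _ (hs i)]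

lemma gaussianReal_one_eq_withDensity (v : ℝ) :
    gaussianReal v 1 =
      (gaussianReal 0 1).withDensity fun x => ENNReal.ofReal (Real.exp (v * x - v ^ 2 / 2)) := by
  rw [gaussianReal_of_var_ne_zero _ one_ne_zero, gaussianReal_of_var_ne_zero _ one_ne_zero,
    ← withDensity_mul _ (measurable_gaussianPDF 0 1) (by fun_prop)]
  congr 1
  ext x
  rw [Pi.mul_apply, gaussianPDF, gaussianPDF, ← ENNReal.ofReal_mul (gaussianPDFReal_nonneg _ _ _),
    gaussianPDFReal, gaussianPDFReal, mul_assoc _ (Real.exp _), ← Real.exp_add]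
  congr 3
  simp
  ring

/-- The Cameron–Martin formula in finite dimension. -/
lemma lintegral_pi_gaussian_add {n : ℕ} (v : Fin n → ℝ) {F : (Fin n → ℝ) → ℝ≥0∞}
    (hF : Measurable F) :
    ∫⁻ z, F (fun i => v i + z i) ∂(Measure.pi fun _ : Fin n => gaussianReal 0 1) =
      ∫⁻ z, ENNReal.ofReal (Real.exp (∑ i, (v i * z i - v i ^ 2 / 2))) * F z
        ∂(Measure.pi fun _ : Fin n => gaussianReal 0 1) := by
  have hd : ∀ i, SigmaFinite ((gaussianReal 0 1).withDensity
      fun x => ENNReal.ofReal (Real.exp (v i * x - v i ^ 2 / 2))) := fun i => by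
    rw [← gaussianReal_one_eq_withDensity]; infer_instance
  have h1 : (Measure.pi fun _ : Fin n => gaussianReal 0 1).map (fun z i => v i + z i) =
      (Measure.pi fun _ : Fin n => gaussianReal 0 1).withDensity
        fun z => ENNReal.ofReal (Real.exp (∑ i, (v i * z i - v i ^ 2 / 2))) := by
    have e : ∀ i, (gaussianReal 0 1).map (fun x => v i + x) = (gaussianReal 0 1).withDensity
      fun x => ENNReal.ofReal (Real.exp (v i * x - v i ^ 2 / 2)) := fun i => by
      rw [gaussianReal_map_const_add, zero_add, gaussianReal_one_eq_withDensity]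
    have hp := Measure.pi_map_pi (μ := fun _ : Fin n => gaussianReal 0 1)
      (f := fun i x => v i + x) (fun i => by fun_prop)
    rw [hp]
    simp_rw [e]
    rw [pi_withDensity_prod _ _ fun i => by fun_prop]
    congr 1
    ext z
    rw [Real.exp_sum, ENNReal.ofReal_prod_of_nonneg fun i _ => (Real.exp_pos _).le]
  have h2 := lintegral_map (μ := Measure.pi fun _ : Fin n => gaussianReal 0 1)
    (f := F) (g := fun z i => v i + z i) hF (by fun_prop)
  rw [← h2, h1, lintegral_withDensity_eq_lintegral_mul _ (by fun_prop) hF]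
  rfl

lemma lintegral_exp_mul_gaussianReal (t : ℝ) :
    ∫⁻ x, ENNReal.ofReal (Real.exp (t * x)) ∂gaussianReal 0 1 =
      ENNReal.ofReal (Real.exp (t ^ 2 / 2)) := by
  rw [← ofReal_integral_eq_lintegral_ofReal (integrable_exp_mul_gaussianReal t)
    (ae_of_all _ fun x => (Real.exp_pos _).le)]
  have := congrFun (mgf_fun_id_gaussianReal (μ := 0) (v := 1)) t
  rw [mgf] at this
  rw [this]
  simp

lemma lintegral_exp_sq_gaussianReal_le {v : ℝ≥0} (hv : v ≠ 0) {s : ℝ} (hs : 2 * s * v < 1) :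
    ∫⁻ x, ENNReal.ofReal (Real.exp (s * x ^ 2)) ∂gaussianReal 0 v ≤
      ENNReal.ofReal (Real.exp (s * v / (1 - 2 * s * v))) := by
  have hv' : (0 : ℝ) < v := by positivity
  have hb : (0 : ℝ) < 1 / (2 * v) - s := by
    rw [sub_pos, lt_div_iff₀ (by positivity)]; linarith
  rw [gaussianReal_of_var_ne_zero _ hv,
    lintegral_withDensity_eq_lintegral_mul _ (measurable_gaussianPDF _ _) (by fun_prop)]
  have h : ∀ x : ℝ, (gaussianPDF 0 v * fun x => ENNReal.ofReal (Real.exp (s * x ^ 2))) x =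
      ENNReal.ofReal ((√(2 * Real.pi * v))⁻¹ * Real.exp (-(1 / (2 * v) - s) * x ^ 2)) := by
    intro x
    rw [Pi.mul_apply, gaussianPDF, ← ENNReal.ofReal_mul (gaussianPDFReal_nonneg _ _ _),
      gaussianPDFReal, mul_assoc, ← Real.exp_add]
    congr 3
    field_simp
    ring
  simp_rw [h]
  rw [← ofReal_integral_eq_lintegral_ofReal ((integrable_exp_neg_mul_sq hb).const_mul _)
    (ae_of_all _ fun x => by positivity), integral_const_mul, integral_gaussian]
  refine ENNReal.ofReal_le_ofReal ?_
  have h1 : (0 : ℝ) < 1 - 2 * s * v := by linarith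
  have e1 : (√(2 * Real.pi * v))⁻¹ * √(Real.pi / (1 / (2 * v) - s)) =
      √(1 + 2 * s * v / (1 - 2 * s * v)) := by
    rw [← Real.sqrt_inv, ← Real.sqrt_mul (by positivity)]
    congr 1
    have h2 := h1.ne'
    have h3 : 1 + 2 * s * v / (1 - 2 * s * v) = 1 / (1 - 2 * s * v) := by
      rw [eq_div_iff h2, add_mul, div_mul_cancel₀ _ h2]; ring
    have : 1 / (2 * (v : ℝ)) - s = (1 - 2 * s * v) / (2 * v) := by field_simp
    rw [h3, this]
    field_simp
  rw [e1]
  refine Real.sqrt_le_iff.2 ⟨(Real.exp_pos _).le, ?_⟩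
  rw [← Real.exp_nat_mul]
  refine le_trans (le_of_eq (add_comm _ _)) ((Real.add_one_le_exp _).trans (le_of_eq ?_))
  congr 1
  push_cast
  ring

/-- Change of measure from a shifted Gaussian vector to the unshifted one, the contribution of
large likelihood ratios being controlled by a Chernoff bound. -/
lemma lintegral_pi_gaussian_add_le {n : ℕ} (v : Fin n → ℝ) {F : (Fin n → ℝ) → ℝ≥0∞}
    (hF : Measurable F) (hF1 : ∀ z, F z ≤ 1) {t : ℝ} (ht : 0 ≤ t) (c : ℝ) :
    ∫⁻ z, F (fun i => v i + z i) ∂(Measure.pi fun _ : Fin n => gaussianReal 0 1) ≤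
      ENNReal.ofReal (Real.exp (-(t * c))) *
          ENNReal.ofReal (Real.exp (∑ i, (t + t ^ 2) / 2 * v i ^ 2)) +
        ENNReal.ofReal (Real.exp c) *
          ∫⁻ z, F z ∂(Measure.pi fun _ : Fin n => gaussianReal 0 1) := by
  have hmom : ∫⁻ z, ENNReal.ofReal (Real.exp ((1 + t) * ∑ i, (v i * z i - v i ^ 2 / 2)))
      ∂(Measure.pi fun _ : Fin n => gaussianReal 0 1) =
      ENNReal.ofReal (Real.exp (∑ i, (t + t ^ 2) / 2 * v i ^ 2)) := by
    have e : ∀ z : Fin n → ℝ,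
        ENNReal.ofReal (Real.exp ((1 + t) * ∑ i, (v i * z i - v i ^ 2 / 2))) =
        ∏ i, (ENNReal.ofReal (Real.exp (-((1 + t) * v i ^ 2 / 2))) *
          ENNReal.ofReal (Real.exp ((1 + t) * v i * z i))) := fun z => by
      rw [Finset.mul_sum, Real.exp_sum, ENNReal.ofReal_prod_of_nonneg fun i _ => (Real.exp_pos _).le]
      refine Finset.prod_congr rfl fun i _ => ?_
      rw [← ENNReal.ofReal_mul (Real.exp_pos _).le, ← Real.exp_add]
      congr 2
      ring
    simp_rw [e]
    rw [lintegral_pi_prod (fun _ : Fin n => gaussianReal 0 1)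
      (fun i x => ENNReal.ofReal (Real.exp (-((1 + t) * v i ^ 2 / 2))) *
          ENNReal.ofReal (Real.exp ((1 + t) * v i * x))) fun i => by fun_prop,
      Real.exp_sum, ENNReal.ofReal_prod_of_nonneg fun i _ => (Real.exp_pos _).le]
    refine Finset.prod_congr rfl fun i _ => ?_
    rw [lintegral_const_mul _ (by fun_prop), lintegral_exp_mul_gaussianReal,
      ← ENNReal.ofReal_mul (Real.exp_pos _).le, ← Real.exp_add]
    congr 2
    ring
  rw [lintegral_pi_gaussian_add v hF, ← hmom, ← lintegral_const_mul _ (by fun_prop),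
    ← lintegral_const_mul _ hF, ← lintegral_add_left (by fun_prop)]
  refine lintegral_mono fun z => ?_
  set L := ∑ i, (v i * z i - v i ^ 2 / 2)
  rcases le_total L c with h | h
  · exact le_add_of_nonneg_of_le zero_le
      (mul_le_mul_left (ENNReal.ofReal_le_ofReal (Real.exp_le_exp.2 h)) _)
  · refine le_add_of_le_of_nonneg ?_ zero_le
    rw [← ENNReal.ofReal_mul (Real.exp_pos _).le, ← Real.exp_add]
    refine (mul_le_of_le_one_right' (hF1 z)).trans
      (ENNReal.ofReal_le_ofReal (Real.exp_le_exp.2 ?_))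
    nlinarith [mul_le_mul_of_nonneg_left h ht]

lemma lintegral_design_exp_le {ι : Type*} [Fintype ι] {n : ℕ} (hn : n ≠ 0) (a : ι) {s : ℝ}
    (hs : 2 * s / n < 1) :
    ∫⁻ X, ENNReal.ofReal (Real.exp (∑ i, s * X i a ^ 2))
      ∂(Measure.pi fun _ : Fin n => Measure.pi fun _ : ι => gaussianReal 0 (n : ℝ≥0)⁻¹) ≤
      ENNReal.ofReal (Real.exp (s / (1 - 2 * s / n))) := by
  simp_rw [Real.exp_sum, ENNReal.ofReal_prod_of_nonneg fun _ _ => (Real.exp_pos _).le]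
  rw [lintegral_pi_prod (fun _ : Fin n => Measure.pi fun _ : ι => gaussianReal 0 (n : ℝ≥0)⁻¹)
    (fun _ x => ENNReal.ofReal (Real.exp (s * x a ^ 2))) fun i => by fun_prop]
  have hm := (measurePreserving_eval (fun _ : ι => gaussianReal 0 (n : ℝ≥0)⁻¹) a).lintegral_comp
    (f := fun x : ℝ => ENNReal.ofReal (Real.exp (s * x ^ 2))) (by fun_prop)
  simp only [Function.eval] at hm
  rw [hm]
  have hb := lintegral_exp_sq_gaussianReal_le (v := (n : ℝ≥0)⁻¹) (s := s) (by simpa using hn)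
    (by simpa [div_eq_mul_inv] using hs)
  refine (Finset.prod_le_prod' fun i _ => hb).trans (le_of_eq ?_)
  rw [Finset.prod_const, Finset.card_univ, Fintype.card_fin,
    ← ENNReal.ofReal_pow (Real.exp_pos _).le, ← Real.exp_nat_mul]
  congr 2
  have : (n : ℝ) ≠ 0 := by exact_mod_cast hn
  push_cast
  rw [← div_eq_mul_inv, ← div_eq_mul_inv, ← mul_div_assoc, mul_div_cancel₀ _ this]

/-- A uniformly random coordinate is guessed correctly, from information independent of it, with
probability at most `1 / m`. -/
lemma sum_apply_le_of_update_invariant {k m : ℕ} (j : Fin k)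
    (f : Fin m → (Fin k → Fin m) → ℝ≥0∞) (hf : ∀ l l' I, f l (Function.update I j l') = f l I)
    (hf1 : ∀ I, ∑ l, f l I ≤ 1) :
    (m : ℝ≥0∞) * ∑ I, f (I j) I ≤ (m : ℝ≥0∞) ^ k := by
  have h1 : ∑ l, ∑ I : Fin k → Fin m, f l I = (m : ℝ≥0∞) * ∑ I, f (I j) I := by
    let e := Equiv.funSplitAt j (Fin m)
    have key : ∀ (g : Fin m → ({i // i ≠ j} → Fin m) → ℝ≥0∞),
        ∑ l, ∑ I : Fin k → Fin m, g l (e I).2 = (m : ℝ≥0∞) * ∑ I, g (I j) (e I).2 := fun g => by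
      have e1 : ∀ l, ∑ I : Fin k → Fin m, g l (e I).2 = (m : ℝ≥0∞) * ∑ r, g l r := fun l => by
        rw [Equiv.sum_comp e fun q => g l q.2, Fintype.sum_prod_type]
        simp
      have e2 : ∑ I, g (I j) (e I).2 = ∑ l, ∑ r, g l r := by
        rw [← Fintype.sum_prod_type']
        exact Equiv.sum_comp e fun q => g q.1 q.2
      rw [e2, Finset.mul_sum]
      exact Finset.sum_congr rfl fun l _ => e1 l
    have hg : ∀ l (I : Fin k → Fin m), f l I = f l (e.symm (l, (e I).2)) := fun l I => by
      rw [← hf l l I]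
      rfl
    have := key fun l r => f l (e.symm (l, r))
    simp_rw [← hg] at this
    exact this
  rw [← h1, Finset.sum_comm]
  refine (Finset.sum_le_sum fun I _ => hf1 I).trans ?_
  simp

lemma isProbabilityMeasure_uniform {m : ℕ} (hm : m ≠ 0) :
    IsProbabilityMeasure (((m : ℝ≥0∞))⁻¹ • (Measure.count : Measure (Fin m))) :=
  ⟨by simp [ENNReal.inv_mul_cancel (Nat.cast_ne_zero.2 hm) (ENNReal.natCast_ne_top m)]⟩

lemma lintegral_pi_uniform {k m : ℕ} (hm : m ≠ 0) (f : (Fin k → Fin m) → ℝ≥0∞) :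
    ∫⁻ I, f I ∂(Measure.pi fun _ : Fin k => ((m : ℝ≥0∞))⁻¹ • Measure.count) =
      ((m : ℝ≥0∞) ^ k)⁻¹ * ∑ I, f I := by
  have := isProbabilityMeasure_uniform hm
  rw [lintegral_fintype, Finset.mul_sum]
  refine Finset.sum_congr rfl fun I _ => ?_
  rw [Measure.pi_singleton]
  simp [mul_comm, ENNReal.inv_pow]

lemma isProbabilityMeasure_blockLaw {n k m : ℕ} (hm : m ≠ 0) :
    IsProbabilityMeasure (blockLaw n k m) := by
  have := isProbabilityMeasure_uniform hm
  unfold blockLaw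
  infer_instance

lemma lintegral_blockLaw {n k m : ℕ} (hm : m ≠ 0) {G : BlockOmega n k m → ℝ≥0∞}
    (hG : Measurable G) :
    ∫⁻ ω, G ω ∂blockLaw n k m = ((m : ℝ≥0∞) ^ k)⁻¹ * ∑ I,
      ∫⁻ X, ∫⁻ z, G ((X, z), I) ∂(Measure.pi fun _ : Fin n => gaussianReal 0 1)
        ∂(Measure.pi fun _ : Fin n =>
          Measure.pi fun _ : Fin k × Fin m => gaussianReal 0 (n : ℝ≥0)⁻¹) := by
  have := isProbabilityMeasure_uniform hm
  rw [blockLaw, lintegral_prod_symm _ hG.aemeasurable, lintegral_pi_uniform hm]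
  congr 1
  refine Finset.sum_congr rfl fun I _ => ?_
  rw [lintegral_prod _ (by fun_prop)]

lemma measurable_blockSignal {k m : ℕ} (lam : ℝ) (jl : Fin k × Fin m) :
    Measurable fun I => blockSignal k m lam I jl :=
  measurable_of_countable _

lemma measurable_blockData (n k m : ℕ) (lam : ℝ) : Measurable (blockData n k m lam) := by
  have := measurable_blockSignal (k := k) (m := m) lam
  unfold blockData
  fun_prop

lemma sum_mul_blockSignal {k m : ℕ} (lam : ℝ) (I : Fin k → Fin m) (x : Fin k × Fin m → ℝ)
    (j : Fin k) :
    ∑ jl, x jl * blockSignal k m lam I jl =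
      lam * x (j, I j) + ∑ i ∈ Finset.univ.erase j, lam * x (i, I i) := by
  rw [Finset.add_sum_erase _ (fun i => lam * x (i, I i)) (Finset.mem_univ j),
    Fintype.sum_prod_type]
  refine Finset.sum_congr rfl fun i _ => ?_
  simp [blockSignal, mul_comm]

/-- Any measurable randomized guess `H` of the spike location of block `j` from the data succeeds
with small probability. -/
lemma lintegral_block_guess_le {n k m : ℕ} (hn : n ≠ 0) (hm : m ≠ 0) (lam : ℝ) (j : Fin k)
    (H : Fin m → (Fin n → (Fin k × Fin m) → ℝ) × (Fin n → ℝ) → ℝ≥0∞)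
    (hH : ∀ l, Measurable (H l)) (hH1 : ∀ d, ∑ l, H l d ≤ 1) {t : ℝ} (ht : 0 ≤ t) (c : ℝ)
    {s : ℝ} (hs : s = (t + t ^ 2) / 2 * lam ^ 2) (hsn : 2 * s / n < 1) :
    ∫⁻ ω, H (ω.2 j) (blockData n k m lam ω) ∂blockLaw n k m ≤
      ENNReal.ofReal (Real.exp (s / (1 - 2 * s / n) - t * c)) +
        ENNReal.ofReal (Real.exp c) * (m : ℝ≥0∞)⁻¹ := by
  have hHle : ∀ l d, H l d ≤ 1 := fun l d =>
    (Finset.single_le_sum (f := fun l => H l d) (fun _ _ => zero_le) (Finset.mem_univ l)).trans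
      (hH1 d)
  have hG : Measurable fun ω : BlockOmega n k m => H (ω.2 j) (blockData n k m lam ω) := by
    have h1 : Measurable fun q : ((Fin n → (Fin k × Fin m) → ℝ) × (Fin n → ℝ)) × Fin m =>
        H q.2 q.1 := measurable_from_prod_countable_left fun l => hH l
    exact h1.comp ((measurable_blockData n k m lam).prodMk (by fun_prop))
  rw [lintegral_blockLaw hm hG]
  set μX := Measure.pi fun _ : Fin n =>
          Measure.pi fun _ : Fin k × Fin m => gaussianReal 0 (n : ℝ≥0)⁻¹
  set μz := Measure.pi fun _ : Fin n => gaussianReal 0 1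
  let u : (Fin k → Fin m) → (Fin n → (Fin k × Fin m) → ℝ) → Fin n → ℝ :=
    fun I X a => ∑ i ∈ Finset.univ.erase j, lam * X a (i, I i)
  have hu : ∀ I, Measurable (u I) := fun I => by fun_prop
  have hmk : (m : ℝ≥0∞) ≠ 0 := Nat.cast_ne_zero.2 hm
  have hmt : (m : ℝ≥0∞) ≠ ∞ := ENNReal.natCast_ne_top m
  have hpt : ∀ I, ∫⁻ X, ∫⁻ z, H (I j) (blockData n k m lam ((X, z), I)) ∂μz ∂μX ≤
      ENNReal.ofReal (Real.exp (s / (1 - 2 * s / n) - t * c)) +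
      ENNReal.ofReal (Real.exp c) * ∫⁻ X, ∫⁻ z, H (I j) (X, fun a => u I X a + z a) ∂μz ∂μX := by
    intro I
    have hmz : Measurable fun q : (Fin n → (Fin k × Fin m) → ℝ) × (Fin n → ℝ) =>
        H (I j) (q.1, fun a => u I q.1 a + q.2 a) := by fun_prop
    have hinner : Measurable fun X => ∫⁻ z, H (I j) (X, fun a => u I X a + z a) ∂μz :=
      hmz.lintegral_prod_right'
    have hX : ∀ X, ∫⁻ z, H (I j) (blockData n k m lam ((X, z), I)) ∂μz ≤
        ENNReal.ofReal (Real.exp (-(t * c))) *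
          ENNReal.ofReal (Real.exp (∑ a, s * X a (j, I j) ^ 2)) +
        ENNReal.ofReal (Real.exp c) * ∫⁻ z, H (I j) (X, fun a => u I X a + z a) ∂μz := fun X => by
      have := lintegral_pi_gaussian_add_le (fun a => lam * X a (j, I j))
        (F := fun z => H (I j) (X, fun a => u I X a + z a)) (by fun_prop) (fun z => hHle _ _) ht c
      refine le_trans (le_of_eq ?_) (this.trans (le_of_eq ?_))
      · refine lintegral_congr fun z =>
          congrArg (H (I j)) (Prod.ext rfl (funext fun a => ?_))
        simp only [blockData, sum_mul_blockSignal lam I _ j, u]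
        ring
      · congr 4
        refine Finset.sum_congr rfl fun a _ => ?_
        rw [hs]; ring
    refine (lintegral_mono hX).trans ?_
    rw [lintegral_add_right _ (by fun_prop), lintegral_const_mul _ (by fun_prop),
      lintegral_const_mul _ hinner]
    gcongr
    refine (mul_le_mul_right (lintegral_design_exp_le hn (j, I j) hsn) _).trans (le_of_eq ?_)
    rw [← ENNReal.ofReal_mul (Real.exp_pos _).le, ← Real.exp_add]
    congr 2
    ring
  have hguess : ∑ I, ∫⁻ X, ∫⁻ z, H (I j) (X, fun a => u I X a + z a) ∂μz ∂μX ≤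
      (m : ℝ≥0∞)⁻¹ * (m : ℝ≥0∞) ^ k := by
    rw [mul_comm, ← div_eq_mul_inv, ENNReal.le_div_iff_mul_le (.inl hmk) (.inl hmt), mul_comm]
    refine sum_apply_le_of_update_invariant j
      (fun l I => ∫⁻ X, ∫⁻ z, H l (X, fun a => u I X a + z a) ∂μz ∂μX) (fun l l' I => ?_)
      fun I => ?_
    · have : u (Function.update I j l') = u I := by
        ext X a
        refine Finset.sum_congr rfl fun i hi => ?_
        rw [Function.update_of_ne (Finset.ne_of_mem_erase hi)]
      simp only [this]
    · have hmz : ∀ l, Measurable fun q : (Fin n → (Fin k × Fin m) → ℝ) × (Fin n → ℝ) =>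
        H l (q.1, fun a => u I q.1 a + q.2 a) := fun l => by fun_prop
      rw [← lintegral_finsetSum _ fun l _ => (hmz l).lintegral_prod_right']
      have : ∀ X, ∑ l, ∫⁻ z, H l (X, fun a => u I X a + z a) ∂μz ≤ 1 := fun X => by
        rw [← lintegral_finsetSum _ fun l _ => by fun_prop]
        exact (lintegral_mono fun z => hH1 _).trans (by simp)
      exact (lintegral_mono this).trans (by simp)
  refine (mul_le_mul_right (Finset.sum_le_sum fun I _ => hpt I) _).trans ?_
  rw [Finset.sum_add_distrib, ← Finset.mul_sum, mul_add]
  have hk0 : (m : ℝ≥0∞) ^ k ≠ 0 := pow_ne_zero _ hmk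
  have hkt : (m : ℝ≥0∞) ^ k ≠ ∞ := ENNReal.pow_ne_top hmt
  refine add_le_add (le_of_eq ?_) ?_
  · simp only [Finset.sum_const, Finset.card_univ, Fintype.card_pi, Fintype.card_fin,
      Finset.prod_const, nsmul_eq_mul]
    rw [← mul_assoc]
    push_cast
    rw [ENNReal.inv_mul_cancel hk0 hkt, one_mul]
  · refine (mul_le_mul_right (mul_le_mul_right hguess _) _).trans (le_of_eq ?_)
    calc _ = ENNReal.ofReal (Real.exp c) * (m : ℝ≥0∞)⁻¹ * (((m : ℝ≥0∞) ^ k)⁻¹ * (m : ℝ≥0∞) ^ k) := by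
          ring
      _ = _ := by rw [ENNReal.inv_mul_cancel hk0 hkt, mul_one]

lemma sum_sub_ite_sq_bounds {m : ℕ} {lam : ℝ} {b : Fin m → ℝ} (hb : ∀ l, 0 ≤ b l)
    (hsum : ∑ l, b l = lam) (i : Fin m) :
    lam ^ 2 - 2 * lam * b i ≤ ∑ l, (b l - if i = l then lam else 0) ^ 2 ∧
      ∑ l, (b l - if i = l then lam else 0) ^ 2 ≤ 2 * lam ^ 2 := by
  have hlam : 0 ≤ lam := hsum ▸ Finset.sum_nonneg fun l _ => hb l
  have hble : ∀ l, b l ≤ lam := fun l =>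
    hsum ▸ Finset.single_le_sum (fun l _ => hb l) (Finset.mem_univ l)
  have hexp : ∑ l, (b l - if i = l then lam else 0) ^ 2 =
      ∑ l, b l ^ 2 + (lam ^ 2 - 2 * lam * b i) := by
    have : ∀ l, (b l - if i = l then lam else 0) ^ 2 =
        b l ^ 2 + if i = l then lam ^ 2 - 2 * lam * b l else 0 := fun l => by
      split_ifs <;> ring
    simp [this, Finset.sum_add_distrib]
  have hsq : ∑ l, b l ^ 2 ≤ lam ^ 2 := by
    calc ∑ l, b l ^ 2 ≤ ∑ l, lam * b l := Finset.sum_le_sum fun l _ => by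
          rw [sq]; exact mul_le_mul_of_nonneg_right (hble l) (hb l)
      _ = lam ^ 2 := by rw [← Finset.mul_sum, hsum, sq]
  rw [hexp]
  exact ⟨le_add_of_nonneg_left (Finset.sum_nonneg fun l _ => sq_nonneg _),
    by nlinarith [mul_nonneg hlam (hb i)]⟩

lemma stronglyMeasurable_blockPostMean {n k m : ℕ} (lam : ℝ) (jl : Fin k × Fin m) :
    StronglyMeasurable (blockPostMean n k m lam jl) :=
  stronglyMeasurable_condExp.mono (measurable_blockData n k m lam).comap_le

lemma exists_measurable_blockPostMean_eq_comp {n k m : ℕ} (lam : ℝ) (jl : Fin k × Fin m) :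
    ∃ g : (Fin n → (Fin k × Fin m) → ℝ) × (Fin n → ℝ) → ℝ,
      Measurable g ∧ ∀ ω, blockPostMean n k m lam jl ω = g (blockData n k m lam ω) := by
  have h : Measurable[MeasurableSpace.comap (blockData n k m lam) inferInstance]
    (blockPostMean n k m lam jl) := stronglyMeasurable_condExp.measurable
  obtain ⟨g, hg, he⟩ := h.exists_eq_measurable_comp
  exact ⟨g, hg, fun ω => congrFun he ω⟩

lemma blockSignal_integrable {n k m : ℕ} (hm : m ≠ 0) (lam : ℝ) (jl : Fin k × Fin m) :
    Integrable (fun ω : BlockOmega n k m => blockSignal k m lam ω.2 jl) (blockLaw n k m) := by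
  have := isProbabilityMeasure_blockLaw (n := n) (k := k) hm
  refine Integrable.of_bound
    ((measurable_blockSignal lam jl).comp measurable_snd).aestronglyMeasurable |lam|
    (ae_of_all _ fun ω => ?_)
  rw [blockSignal, Real.norm_eq_abs]
  split_ifs <;> simp

lemma blockPostMean_nonneg {n k m : ℕ} {lam : ℝ} (hlam : 0 ≤ lam) :
    ∀ᵐ ω ∂blockLaw n k m, ∀ jl, 0 ≤ blockPostMean n k m lam jl ω := by
  refine ae_all_iff.2 fun jl => condExp_nonneg (ae_of_all _ fun ω => ?_)
  simp only [blockSignal]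
  split_ifs <;> simp [hlam]

lemma sum_blockPostMean {n k m : ℕ} (hm : m ≠ 0) (lam : ℝ) :
    ∀ᵐ ω ∂blockLaw n k m, ∀ j, ∑ l, blockPostMean n k m lam (j, l) ω = lam := by
  have := isProbabilityMeasure_blockLaw (n := n) (k := k) hm
  refine ae_all_iff.2 fun j => ?_
  have h := condExp_finsetSum (μ := blockLaw n k m) (s := Finset.univ)
    (f := fun l ω => blockSignal k m lam ω.2 (j, l))
    (fun l _ => blockSignal_integrable hm lam (j, l))
    (MeasurableSpace.comap (blockData n k m lam) inferInstance)
  have hc : (∑ l, fun ω : BlockOmega n k m => blockSignal k m lam ω.2 (j, l)) =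
      fun _ => lam := by
    ext ω
    simp [blockSignal]
  rw [hc, condExp_const (measurable_blockData n k m lam).comap_le] at h
  filter_upwards [h] with ω hω
  rw [Finset.sum_apply] at hω
  exact hω.symm

lemma integral_blockPostMean_at_spike_le {n k m : ℕ} (hm : m ≠ 0) {lam : ℝ} (hlam : 0 < lam)
    (j : Fin k) {r : ℝ} (hr0 : 0 ≤ r)
    (hr : ∀ H : Fin m → (Fin n → (Fin k × Fin m) → ℝ) × (Fin n → ℝ) → ℝ≥0∞,
      (∀ l, Measurable (H l)) → (∀ d, ∑ l, H l d ≤ 1) →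
      ∫⁻ ω, H (ω.2 j) (blockData n k m lam ω) ∂blockLaw n k m ≤ ENNReal.ofReal r) :
    Integrable (fun ω => blockPostMean n k m lam (j, ω.2 j) ω) (blockLaw n k m) ∧
      ∫ ω, blockPostMean n k m lam (j, ω.2 j) ω ∂blockLaw n k m ≤ lam * r := by
  have := isProbabilityMeasure_blockLaw (n := n) (k := k) hm
  choose g hg hB using fun l : Fin m => exists_measurable_blockPostMean_eq_comp (n := n) lam (j, l)
  have hmeas : Measurable fun ω : BlockOmega n k m => blockPostMean n k m lam (j, ω.2 j) ω := by
    have h1 : Measurable fun q : BlockOmega n k m × Fin m =>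
        blockPostMean n k m lam (j, q.2) q.1 := measurable_from_prod_countable_left fun l =>
      (stronglyMeasurable_blockPostMean lam (j, l)).measurable
    exact h1.comp (measurable_id.prodMk (by fun_prop))
  have hnn := blockPostMean_nonneg (n := n) (k := k) (m := m) hlam.le
  have hs := sum_blockPostMean (n := n) (k := k) hm lam
  have hint : Integrable (fun ω => blockPostMean n k m lam (j, ω.2 j) ω) (blockLaw n k m) := by
    refine Integrable.of_bound hmeas.aestronglyMeasurable lam ?_
    filter_upwards [hnn, hs] with ω h1 h2
    rw [Real.norm_of_nonneg (h1 _)]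
    exact (Finset.single_le_sum (f := fun l => blockPostMean n k m lam (j, l) ω)
      (fun l _ => h1 _) (Finset.mem_univ _)).trans_eq (h2 j)
  refine ⟨hint, ?_⟩
  let D := {d | (∀ l, 0 ≤ g l d) ∧ ∑ l, g l d = lam}
  have hD : MeasurableSet D := by
    refine MeasurableSet.inter ?_ (measurableSet_eq_fun (by fun_prop) measurable_const)
    exact measurableSet_setOfPred.2 (Measurable.forall fun l =>
      measurableSet_setOfPred.1 (measurableSet_le measurable_const (hg l)))
  have hH := hr (fun l => D.indicator fun d => ENNReal.ofReal (g l d / lam))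
    (fun l => Measurable.indicator (by fun_prop) hD) fun d => by
      by_cases hd : d ∈ D
      · simp only [Set.indicator_of_mem hd]
        rw [← ENNReal.ofReal_sum_of_nonneg fun l _ => div_nonneg (hd.1 l) hlam.le,
          ← Finset.sum_div, hd.2, div_self hlam.ne', ENNReal.ofReal_one]
      · simp [Set.indicator_of_notMem hd]
  have hae : ∫⁻ ω, ENNReal.ofReal (blockPostMean n k m lam (j, ω.2 j) ω / lam)
      ∂blockLaw n k m ≤ ENNReal.ofReal r := by
    refine (le_of_eq (lintegral_congr_ae ?_)).trans hH
    filter_upwards [hnn, hs] with ω h1 h2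
    have hd : blockData n k m lam ω ∈ D :=
      ⟨fun l => hB l ω ▸ h1 (j, l), by simp_rw [← hB]; exact h2 j⟩
    simp only [Set.indicator_of_mem hd, hB]
  have h3 : ∫ ω, blockPostMean n k m lam (j, ω.2 j) ω / lam ∂blockLaw n k m ≤ r := by
    rw [integral_eq_lintegral_of_nonneg_ae _ (hint.div_const lam).aestronglyMeasurable]
    · exact ENNReal.toReal_le_of_le_ofReal hr0 hae
    · filter_upwards [hnn] with ω h1
      exact div_nonneg (h1 _) hlam.le
  rw [integral_div, div_le_iff₀ hlam] at h3
  linarith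

lemma blockBayesRisk_bounds {n k m : ℕ} (hm : m ≠ 0) {lam : ℝ} (hlam : 0 < lam)
    {r : ℝ} (hr0 : 0 ≤ r)
    (hr : ∀ (j : Fin k) (H : Fin m → (Fin n → (Fin k × Fin m) → ℝ) × (Fin n → ℝ) → ℝ≥0∞),
      (∀ l, Measurable (H l)) → (∀ d, ∑ l, H l d ≤ 1) →
      ∫⁻ ω, H (ω.2 j) (blockData n k m lam ω) ∂blockLaw n k m ≤ ENNReal.ofReal r) :
    k * lam ^ 2 * (1 - 2 * r) ≤ blockBayesRisk n k m lam ∧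
      blockBayesRisk n k m lam ≤ 2 * (k * lam ^ 2) := by
  have := isProbabilityMeasure_blockLaw (n := n) (k := k) hm
  have hbd : ∀ᵐ ω ∂blockLaw n k m, ∀ j,
      lam ^ 2 - 2 * lam * blockPostMean n k m lam (j, ω.2 j) ω ≤
        ∑ l, (blockPostMean n k m lam (j, l) ω - blockSignal k m lam ω.2 (j, l)) ^ 2 ∧
      ∑ l, (blockPostMean n k m lam (j, l) ω - blockSignal k m lam ω.2 (j, l)) ^ 2 ≤
        2 * lam ^ 2 := by
    filter_upwards [blockPostMean_nonneg (n := n) (k := k) (m := m) hlam.le,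
      sum_blockPostMean (n := n) (k := k) hm lam] with ω h1 h2
    exact fun j => sum_sub_ite_sq_bounds (fun l => h1 (j, l)) (h2 j) (ω.2 j)
  have hupper : ∀ᵐ ω ∂blockLaw n k m,
      ∑ jl, (blockPostMean n k m lam jl ω - blockSignal k m lam ω.2 jl) ^ 2 ≤
        2 * (k * lam ^ 2) := by
    filter_upwards [hbd] with ω hω
    rw [Fintype.sum_prod_type]
    refine (Finset.sum_le_sum fun j _ => (hω j).2).trans (le_of_eq ?_)
    simp
    ring
  have hlower : ∀ᵐ ω ∂blockLaw n k m,
      ∑ j, (lam ^ 2 - 2 * lam * blockPostMean n k m lam (j, ω.2 j) ω) ≤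
      ∑ jl, (blockPostMean n k m lam jl ω - blockSignal k m lam ω.2 jl) ^ 2 := by
    filter_upwards [hbd] with ω hω
    rw [Fintype.sum_prod_type]
    exact Finset.sum_le_sum fun j _ => (hω j).1
  have hint : Integrable (fun ω =>
      ∑ jl, (blockPostMean n k m lam jl ω - blockSignal k m lam ω.2 jl) ^ 2)
      (blockLaw n k m) := by
    refine Integrable.of_bound (Measurable.aestronglyMeasurable ?_) (2 * (k * lam ^ 2)) ?_
    · exact Finset.measurable_sum _ fun jl _ =>
        ((stronglyMeasurable_blockPostMean lam jl).measurable.sub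
          ((measurable_blockSignal lam jl).comp measurable_snd)).pow_const 2
    · filter_upwards [hupper] with ω hω
      rwa [Real.norm_of_nonneg (Finset.sum_nonneg fun _ _ => sq_nonneg _)]
  have hspike := fun j => integral_blockPostMean_at_spike_le (n := n) hm hlam j hr0 (hr j)
  have hterm : ∀ j, Integrable (fun ω =>
      lam ^ 2 - 2 * lam * blockPostMean n k m lam (j, ω.2 j) ω) (blockLaw n k m) := fun j =>
    (integrable_const _).sub ((hspike j).1.const_mul _)
  constructor
  · refine le_trans ?_ (integral_mono_ae (integrable_finsetSum _ fun j _ => hterm j) hint hlower)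
    rw [integral_finsetSum _ fun j _ => hterm j]
    have : ∀ j, lam ^ 2 * (1 - 2 * r) ≤
        ∫ ω, lam ^ 2 - 2 * lam * blockPostMean n k m lam (j, ω.2 j) ω ∂blockLaw n k m := by
      intro j
      rw [integral_sub (integrable_const _) ((hspike j).1.const_mul _), integral_const_mul]
      simp only [integral_const, probReal_univ, one_smul]
      nlinarith [mul_le_mul_of_nonneg_left (hspike j).2 hlam.le]
    refine le_trans (le_of_eq ?_) (Finset.sum_le_sum fun j _ => this j)
    simp
    ring
  · refine (integral_mono_ae hint (integrable_const _) hupper).trans (le_of_eq ?_)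
    simp

lemma tilt_exponent_le {δ : ℝ} (hδ : δ ∈ Set.Ioo (0 : ℝ) 1) {L lam N s : ℝ} (hL : 0 ≤ L)
    (hlam : lam ^ 2 ≤ (2 - δ) * L) (hs : s = (δ / 16 + (δ / 16) ^ 2) / 2 * lam ^ 2)
    (hsN : 2 * s / N ≤ δ / 16) :
    s / (1 - 2 * s / N) - δ / 16 * ((1 - δ / 4) * L) ≤ -(δ ^ 2 / 128) * L := by
  obtain ⟨h0, h1⟩ := hδ
  have hd : 1 - δ / 16 ≤ 1 - 2 * s / N := by linarith
  have hd0 : 0 < 1 - 2 * s / N := by linarith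
  have hle : s / (1 - 2 * s / N) ≤ δ / 16 * (1 - 3 * δ / 8) * L := by
    rw [div_le_iff₀ hd0]
    calc s ≤ (δ / 16 + (δ / 16) ^ 2) / 2 * ((2 - δ) * L) := by
          rw [hs]; exact mul_le_mul_of_nonneg_left hlam (by positivity)
      _ ≤ δ / 16 * (1 - 3 * δ / 8) * L * (1 - δ / 16) := by
          have : 0 ≤ δ * L * δ ^ 2 := by positivity
          nlinarith
      _ ≤ _ := mul_le_mul_of_nonneg_left hd
          (mul_nonneg (mul_nonneg (by positivity) (by linarith)) hL)
  linarith

/-- **Proposition 3.** For the independent block prior `π = π_IB(λ; p, k)` (blocks of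
size `m = p/k`), if `(log(p/k))/n → 0`, `p/k → ∞`, `λ > 0` and
`λ² ≤ (2−δ) log(p/k)` for a fixed `δ ∈ (0,1)`, then
`E_π ‖β̂_π − β‖₂² ≥ k λ² (1 + o(1))`. -/
theorem block_prior_bayes_risk_lower
    (k m : ℕ → ℕ) (lam : ℕ → ℝ) (δ : ℝ) (hδ : δ ∈ Set.Ioo (0 : ℝ) 1)
    (hk : ∀ n, 0 < k n)
    (hm : Tendsto (fun n => (m n : ℝ)) atTop atTop)
    (hlog : Tendsto (fun n => Real.log (m n) / n) atTop (nhds 0))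
    (hlam : ∀ n, 0 < lam n)
    (hlam2 : ∀ n, lam n ^ 2 ≤ (2 - δ) * Real.log (m n)) :
    1 ≤ Filter.liminf
        (fun n => blockBayesRisk n (k n) (m n) (lam n) / (k n * lam n ^ 2)) atTop := by
  have hℓ : Tendsto (fun n => Real.log (m n)) atTop atTop := Real.tendsto_log_atTop.comp hm
  have hδ0 := hδ.1
  set C := δ / 16 + (δ / 16) ^ 2
  have hC0 : 0 < C := by positivity
  let r : ℕ → ℝ := fun n =>
    Real.exp (-(δ ^ 2 / 128) * Real.log (m n)) + Real.exp (-(δ / 4) * Real.log (m n))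
  have hexp : ∀ a : ℝ, 0 < a → Tendsto (fun n => Real.exp (-a * Real.log (m n))) atTop (nhds 0) :=
    fun a ha => Real.tendsto_exp_atBot.comp (hℓ.const_mul_atTop_of_neg (neg_neg_of_pos ha))
  have hr : Tendsto r atTop (nhds 0) := by
    simpa [r] using (hexp (δ ^ 2 / 128) (by positivity)).add (hexp (δ / 4) (by positivity))
  have hsmall : ∀ᶠ n : ℕ in atTop, C * ((2 - δ) * (Real.log (m n) / n)) ≤ δ / 16 := by
    have := (hlog.const_mul (2 - δ)).const_mul C
    rw [mul_zero, mul_zero] at this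
    exact this.eventually_le_const (by positivity)
  have hbounds : ∀ᶠ n in atTop, 1 - 2 * r n ≤
      blockBayesRisk n (k n) (m n) (lam n) / (k n * lam n ^ 2) ∧
      blockBayesRisk n (k n) (m n) (lam n) / (k n * lam n ^ 2) ≤ 2 := by
    filter_upwards [hsmall, eventually_ne_atTop 0, hℓ.eventually_ge_atTop 0,
      hm.eventually_gt_atTop 0] with n hsm hn hL hmpos
    have hm0 : m n ≠ 0 := by exact_mod_cast hmpos.ne'
    have hden : (0 : ℝ) < k n * lam n ^ 2 :=
      mul_pos (by exact_mod_cast hk n) (pow_pos (hlam n) 2)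
    have hsN : 2 * (C / 2 * lam n ^ 2) / n ≤ δ / 16 := by
      refine le_trans (le_trans (le_of_eq ?_)
        (mul_le_mul_of_nonneg_left (div_le_div_of_nonneg_right (hlam2 n) n.cast_nonneg) hC0.le))
        ((le_of_eq ?_).trans hsm)
      · ring
      · ring
    rw [le_div_iff₀ hden, div_le_iff₀ hden, mul_comm (1 - 2 * r n)]
    refine blockBayesRisk_bounds hm0 (hlam n) (r := r n) (by positivity) fun j H hH hH1 => ?_
    refine (lintegral_block_guess_le hn hm0 (lam n) j H hH hH1 (t := δ / 16) (by positivity)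
      ((1 - δ / 4) * Real.log (m n)) rfl (by linarith [hδ.2])).trans ?_
    rw [ENNReal.ofReal_add (Real.exp_pos _).le (Real.exp_pos _).le]
    refine add_le_add (ENNReal.ofReal_le_ofReal (Real.exp_le_exp.2
      (tilt_exponent_le hδ hL (hlam2 n) rfl hsN))) (le_of_eq ?_)
    rw [← ENNReal.ofReal_natCast, ← ENNReal.ofReal_inv_of_pos hmpos,
      ← ENNReal.ofReal_mul (Real.exp_pos _).le]
    nth_rewrite 2 [← Real.exp_log hmpos]
    rw [← Real.exp_neg, ← Real.exp_add]
    congr 2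
    ring
  have hlim : Tendsto (fun n => 1 - 2 * r n) atTop (nhds 1) := by
    simpa using (hr.const_mul 2).const_sub 1
  rw [← hlim.liminf_eq]
  exact liminf_le_liminf (hbounds.mono fun n h => h.1) hlim.isBoundedUnder_ge
    (IsBoundedUnder.isCoboundedUnder_ge ⟨2, eventually_map.2 (hbounds.mono fun n h => h.2)⟩)
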